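/- Imprecise Sklar theorem for fixed margins, conditions (2) ⇔ (3): Let A ≤ B be bivariate quasi-distributions with the same margins F_X and F_Y. Then the following are equivalent: (2) 𝔇(A,B) is nonempty and A = inf 𝔇(A,B), B = sup 𝔇(A,B) pointwise; (3) there exist quasi-copulas P ≤ Q such that A(x,y) = P(F_X(x),F_Y(y)) and B(x,y) = Q(F_X(x),F_Y(y)) for all (x,y), and (P,Q) is a coherent imprecise copula. -/

import Mathlib

open scoped Classical

noncomputable section

/-- The `F`-volume of the rectangle `[a₁,a₂] × [b₁,b₂]`. -/
def vol (F : EReal × EReal → ℝ) (a₁ a₂ b₁ b₂ : EReal) : ℝ :=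
  F (a₂, b₂) - F (a₁, b₂) - F (a₂, b₁) + F (a₁, b₁)

/-- `x ∈ R̄` is an infinite value, i.e. `−∞` or `+∞`. -/
def IsInfinite (x : EReal) : Prop := x = ⊥ ∨ x = ⊤

/-- A bivariate quasi-distribution on `R̄²`. -/
def IsQuasiDist (F : EReal × EReal → ℝ) : Prop :=
  (∀ p : EReal × EReal, F p ∈ Set.Icc (0:ℝ) 1) ∧
  (∀ x : EReal, F (x, ⊥) = 0) ∧ (∀ y : EReal, F (⊥, y) = 0) ∧
  F (⊤, ⊤) = 1 ∧
  (∀ a₁ a₂ b₁ b₂ : EReal, a₁ ≤ a₂ → b₁ ≤ b₂ →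
    (IsInfinite a₁ ∨ IsInfinite a₂ ∨ IsInfinite b₁ ∨ IsInfinite b₂) →
    0 ≤ vol F a₁ a₂ b₁ b₂)

/-- A bivariate distribution on `R̄²` (no right-continuity assumed). -/
def IsDist (F : EReal × EReal → ℝ) : Prop :=
  (∀ p : EReal × EReal, F p ∈ Set.Icc (0:ℝ) 1) ∧
  (∀ x : EReal, F (x, ⊥) = 0) ∧ (∀ y : EReal, F (⊥, y) = 0) ∧
  F (⊤, ⊤) = 1 ∧
  (∀ a₁ a₂ b₁ b₂ : EReal, a₁ ≤ a₂ → b₁ ≤ b₂ → 0 ≤ vol F a₁ a₂ b₁ b₂)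

/-- `F` has margins `FX` and `FY`. -/
def HasMargins (F : EReal × EReal → ℝ) (FX FY : EReal → ℝ) : Prop :=
  (∀ x, F (x, ⊤) = FX x) ∧ (∀ y, F (⊤, y) = FY y)

/-- A univariate distribution function on `R̄` (no right-continuity assumed). -/
def UnivDist (F : EReal → ℝ) : Prop :=
  Monotone F ∧ F ⊥ = 0 ∧ F ⊤ = 1

/-- A (nondegenerate) rectangle in `R̄²` with distinct standard corners. -/
structure Rect where
  x1 : EReal
  y1 : EReal
  x2 : EReal
  y2 : EReal
  hx : x1 < x2
  hy : y1 < y2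

/-- The multiplicity of a point with respect to a rectangle: `+1` at the main
corners (southwest and northeast), `−1` at the opposite corners. -/
def Rect.mult (R : Rect) (p : EReal × EReal) : ℤ :=
  (if p = (R.x1, R.y1) then 1 else 0) + (if p = (R.x2, R.y2) then 1 else 0)
    - (if p = (R.x2, R.y1) then 1 else 0) - (if p = (R.x1, R.y2) then 1 else 0)

/-- The interior of a rectangle, as a subset of `R̄²`. -/
def Rect.inter (R : Rect) : Set (EReal × EReal) :=
  Set.Ioo R.x1 R.x2 ×ˢ Set.Ioo R.y1 R.y2

/-- The image of a rectangle under the reflection `δ(x,y) = (−x,y)`. -/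
def Rect.reflect (R : Rect) : Rect where
  x1 := -R.x2
  y1 := R.y1
  x2 := -R.x1
  y2 := R.y2
  hx := EReal.neg_lt_neg_iff.mpr R.hx
  hy := R.hy

/-- A finite (formal) union of rectangles is represented by a list; membership in `ℜ`
additionally requires pairwise disjointness, see `disjU`. -/
def disjU (U : List Rect) : Prop :=
  U.Pairwise fun R S => Disjoint R.inter S.inter

/-- The multiplicity of a point with respect to a finite union of rectangles. -/
def multU (U : List Rect) (p : EReal × EReal) : ℤ :=
  (U.map fun R => R.mult p).sum

/-- The corners of a rectangle, as a list. -/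
def Rect.cornerList (R : Rect) : List (EReal × EReal) :=
  [(R.x1, R.y1), (R.x2, R.y2), (R.x2, R.y1), (R.x1, R.y2)]

/-- The set of corners of a finite union of rectangles. -/
def cornersU (U : List Rect) : Finset (EReal × EReal) :=
  (U.flatMap Rect.cornerList).toFinset

/-- `L^{(A,B)}(R) = Σ_{m_R(y)>0} B(y)·m_R(y) + Σ_{m_R(y)<0} A(y)·m_R(y)`. -/
def Lval (A B : EReal × EReal → ℝ) (U : List Rect) : ℝ :=
  ∑ p ∈ cornersU U,
    (if 0 < multU U p then B p * (multU U p : ℝ)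
     else if multU U p < 0 then A p * (multU U p : ℝ) else 0)

/-- Condition (Q1): `A ≤ B` pointwise. -/
def CondQ1 (A B : EReal × EReal → ℝ) : Prop := ∀ p, A p ≤ B p

/-- Condition (Q2): `L^{(A,B)}(R) ≥ 0` for all `R ∈ ℜ`. -/
def CondQ2 (A B : EReal × EReal → ℝ) : Prop :=
  ∀ U : List Rect, disjU U → 0 ≤ Lval A B U

/-- `P_O^{(A,B)}(x) = inf { L^{(A,B)}(R)/(−m_R(x)) : R ∈ ℜ, m_R(x) < 0 }`,
with the infimum of the empty set being `+∞`. -/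
def PO (A B : EReal × EReal → ℝ) (x : EReal × EReal) : EReal :=
  ⨅ U : {U : List Rect // disjU U ∧ multU U x < 0},
    ((Lval A B U.1 / (-(multU U.1 x) : ℝ) : ℝ) : EReal)

/-- `P_M^{(A,B)}(x) = inf { L^{(A,B)}(R)/m_R(x) : R ∈ ℜ, m_R(x) > 0 }`,
with the infimum of the empty set being `+∞`. -/
def PM (A B : EReal × EReal → ℝ) (x : EReal × EReal) : EReal :=
  ⨅ U : {U : List Rect // disjU U ∧ 0 < multU U x},
    ((Lval A B U.1 / ((multU U.1 x) : ℝ) : ℝ) : EReal)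

/-- `γ^{(A,B)}(x) = min { P_O^{(A,B)}(x), B(x) − A(x) }`. -/
def gammaAB (A B : EReal × EReal → ℝ) (x : EReal × EReal) : EReal :=
  min (PO A B x) ((B x - A x : ℝ) : EReal)

/-- A quasi-copula on `[0,1]²`. -/
def IsQuasiCopula (Q : ℝ → ℝ → ℝ) : Prop :=
  (∀ u ∈ Set.Icc (0:ℝ) 1, ∀ v ∈ Set.Icc (0:ℝ) 1, Q u v ∈ Set.Icc (0:ℝ) 1) ∧
  (∀ u ∈ Set.Icc (0:ℝ) 1, Q u 0 = 0 ∧ Q 0 u = 0 ∧ Q u 1 = u ∧ Q 1 u = u) ∧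
  (∀ u ∈ Set.Icc (0:ℝ) 1, ∀ u' ∈ Set.Icc (0:ℝ) 1, ∀ v ∈ Set.Icc (0:ℝ) 1,
    u ≤ u' → Q u v ≤ Q u' v ∧ Q v u ≤ Q v u') ∧
  (∀ u ∈ Set.Icc (0:ℝ) 1, ∀ u' ∈ Set.Icc (0:ℝ) 1, ∀ v ∈ Set.Icc (0:ℝ) 1,
    ∀ v' ∈ Set.Icc (0:ℝ) 1, |Q u v - Q u' v'| ≤ |u - u'| + |v - v'|)

/-- A copula on `[0,1]²`. -/
def IsCopula (C : ℝ → ℝ → ℝ) : Prop :=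
  (∀ u ∈ Set.Icc (0:ℝ) 1, ∀ v ∈ Set.Icc (0:ℝ) 1, C u v ∈ Set.Icc (0:ℝ) 1) ∧
  (∀ u ∈ Set.Icc (0:ℝ) 1, C u 0 = 0 ∧ C 0 u = 0 ∧ C u 1 = u ∧ C 1 u = u) ∧
  (∀ u₁ ∈ Set.Icc (0:ℝ) 1, ∀ u₂ ∈ Set.Icc (0:ℝ) 1, ∀ v₁ ∈ Set.Icc (0:ℝ) 1,
    ∀ v₂ ∈ Set.Icc (0:ℝ) 1, u₁ ≤ u₂ → v₁ ≤ v₂ →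
    0 ≤ C u₂ v₂ - C u₁ v₂ - C u₂ v₁ + C u₁ v₁)

/-- `𝒞(P,Q)`: the set of copulas lying pointwise between `P` and `Q` on `[0,1]²`. -/
def Cset (P Q : ℝ → ℝ → ℝ) : Set (ℝ → ℝ → ℝ) :=
  {C | IsCopula C ∧ ∀ u ∈ Set.Icc (0:ℝ) 1, ∀ v ∈ Set.Icc (0:ℝ) 1,
    P u v ≤ C u v ∧ C u v ≤ Q u v}

/-- `(P,Q)` is a coherent imprecise copula. -/
def CoherentImprecise (P Q : ℝ → ℝ → ℝ) : Prop :=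
  IsQuasiCopula P ∧ IsQuasiCopula Q ∧
  (∀ u ∈ Set.Icc (0:ℝ) 1, ∀ v ∈ Set.Icc (0:ℝ) 1, P u v ≤ Q u v) ∧
  (Cset P Q).Nonempty ∧
  (∀ u ∈ Set.Icc (0:ℝ) 1, ∀ v ∈ Set.Icc (0:ℝ) 1,
    P u v = sInf ((fun C => C u v) '' Cset P Q) ∧
    Q u v = sSup ((fun C => C u v) '' Cset P Q))

/-- `𝔇(A,B)`: the set of bivariate distributions with margins `FX`, `FY`
lying pointwise between `A` and `B`. -/
def Dset (FX FY : EReal → ℝ) (A B : EReal × EReal → ℝ) : Set (EReal × EReal → ℝ) :=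
  {F | IsDist F ∧ HasMargins F FX FY ∧ ∀ p, A p ≤ F p ∧ F p ≤ B p}

/-- The pointwise infimum of a set of bivariate functions. -/
def pinf (S : Set (EReal × EReal → ℝ)) : EReal × EReal → ℝ :=
  fun p => sInf ((fun F => F p) '' S)

/-- The pointwise supremum of a set of bivariate functions. -/
def psup (S : Set (EReal × EReal → ℝ)) : EReal × EReal → ℝ :=
  fun p => sSup ((fun F => F p) '' S)

/-- `S` is a coherent restricted bivariate `p`-box with margins `FX`, `FY`. -/
def CoherentPBox (FX FY : EReal → ℝ) (S : Set (EReal × EReal → ℝ)) : Prop :=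
  S.Nonempty ∧ (∀ F ∈ S, IsDist F ∧ HasMargins F FX FY) ∧
  S = Dset FX FY (pinf S) (psup S) ∧
  (∀ p, pinf S p = pinf (Dset FX FY (pinf S) (psup S)) p) ∧
  (∀ p, psup S p = psup (Dset FX FY (pinf S) (psup S)) p)

/-- A mesh `Δ = δ_x × δ_y`. -/
structure Mesh where
  sx : Finset EReal
  sy : Finset EReal
  botx : ⊥ ∈ sx
  topx : ⊤ ∈ sx
  boty : ⊥ ∈ sy
  topy : ⊤ ∈ sy
  posx : ∃ a ∈ sx, 0 < a ∧ a ≠ ⊤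
  negx : ∃ a ∈ sx, a < 0 ∧ a ≠ ⊥
  posy : ∃ a ∈ sy, 0 < a ∧ a ≠ ⊤
  negy : ∃ a ∈ sy, a < 0 ∧ a ≠ ⊥

/-- A discrete bivariate quasi-distribution on the mesh `Δ`. -/
def DiscQuasiDist (Δ : Mesh) (F : EReal × EReal → ℝ) : Prop :=
  (∀ x ∈ Δ.sx, ∀ y ∈ Δ.sy, F (x, y) ∈ Set.Icc (0:ℝ) 1) ∧
  (∀ x ∈ Δ.sx, F (x, ⊥) = 0) ∧ (∀ y ∈ Δ.sy, F (⊥, y) = 0) ∧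
  F (⊤, ⊤) = 1 ∧
  (∀ a₁ ∈ Δ.sx, ∀ a₂ ∈ Δ.sx, ∀ b₁ ∈ Δ.sy, ∀ b₂ ∈ Δ.sy, a₁ ≤ a₂ → b₁ ≤ b₂ →
    (IsInfinite a₁ ∨ IsInfinite a₂ ∨ IsInfinite b₁ ∨ IsInfinite b₂) →
    0 ≤ vol F a₁ a₂ b₁ b₂)

/-- A discrete bivariate distribution on the mesh `Δ`. -/
def DiscDist (Δ : Mesh) (F : EReal × EReal → ℝ) : Prop :=
  (∀ x ∈ Δ.sx, ∀ y ∈ Δ.sy, F (x, y) ∈ Set.Icc (0:ℝ) 1) ∧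
  (∀ x ∈ Δ.sx, F (x, ⊥) = 0) ∧ (∀ y ∈ Δ.sy, F (⊥, y) = 0) ∧
  F (⊤, ⊤) = 1 ∧
  (∀ a₁ ∈ Δ.sx, ∀ a₂ ∈ Δ.sx, ∀ b₁ ∈ Δ.sy, ∀ b₂ ∈ Δ.sy, a₁ ≤ a₂ → b₁ ≤ b₂ →
    0 ≤ vol F a₁ a₂ b₁ b₂)

/-- All rectangles of the union have their corners in the mesh `Δ`. -/
def inMeshU (Δ : Mesh) (U : List Rect) : Prop :=
  ∀ R ∈ U, R.x1 ∈ Δ.sx ∧ R.x2 ∈ Δ.sx ∧ R.y1 ∈ Δ.sy ∧ R.y2 ∈ Δ.sy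

/-- The reflection `A^δ(x,y) = F_Y(y) − A(−x,y)` of `A` having second margin `FY`. -/
def reflectFun (FY : EReal → ℝ) (A : EReal × EReal → ℝ) : EReal × EReal → ℝ :=
  fun p => FY p.2 - A (-p.1, p.2)

end

lemma MonotoneOn.closure_of_continuous {h : ℝ → ℝ} {D : Set ℝ} (hm : MonotoneOn h D)
    (hc : Continuous h) : MonotoneOn h (closure D) := by
  intro s hs t ht hst
  rcases hst.eq_or_lt with rfl | hlt
  · exact le_rfl
  obtain ⟨x, hxD, hx⟩ := mem_closure_iff_seq_limit.1 hs
  obtain ⟨y, hyD, hy⟩ := mem_closure_iff_seq_limit.1 ht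
  refine le_of_tendsto_of_tendsto ((hc.tendsto s).comp hx) ((hc.tendsto t).comp hy) ?_
  filter_upwards [hx.eventually_lt hy hlt] with n hn
  exact hm (hxD n) (hyD n) hn.le

/-- A linear positive extension operator from functions on a closed subset `K` of `[0,1]`
containing both endpoints to functions on `[0,1]`, given by linear interpolation in the gaps. -/
lemma exists_interpolation_operator {K : Set ℝ} (hK : IsClosed K) (hK1 : K ⊆ Set.Icc 0 1)
    (h0 : (0 : ℝ) ∈ K) (h1 : (1 : ℝ) ∈ K) :
    ∃ I : (ℝ → ℝ) → ℝ → ℝ,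
      (∀ h k u, I (fun s => h s - k s) u = I h u - I k u) ∧
      (∀ h, ∀ u ∈ K, I h u = h u) ∧
      (∀ u ∈ Set.Icc (0 : ℝ) 1, I (fun s => s) u = u) ∧
      (∀ h k, Set.EqOn h k K → Set.EqOn (I h) (I k) (Set.Icc 0 1)) ∧
      (∀ h, MonotoneOn h K → MonotoneOn (I h) (Set.Icc 0 1)) := by
  have hc : IsCompact K := isCompact_Icc.of_isClosed_subset hK hK1
  have exa : ∀ u : ℝ, ∃ a, u ∈ Set.Icc (0 : ℝ) 1 → a ∈ K ∧ a ≤ u ∧ ∀ k ∈ K, k ≤ u → k ≤ a := by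
    intro u
    by_cases hu : u ∈ Set.Icc (0 : ℝ) 1
    · have hcu : IsCompact (K ∩ Set.Iic u) := hc.inter_right isClosed_Iic
      have hm := hcu.sSup_mem ⟨0, h0, hu.1⟩
      exact ⟨_, fun _ => ⟨hm.1, hm.2, fun k hk hku => le_csSup hcu.bddAbove ⟨hk, hku⟩⟩⟩
    · exact ⟨0, fun h => absurd h hu⟩
  have exb : ∀ u : ℝ, ∃ b, u ∈ Set.Icc (0 : ℝ) 1 → b ∈ K ∧ u ≤ b ∧ ∀ k ∈ K, u ≤ k → b ≤ k := by
    intro u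
    by_cases hu : u ∈ Set.Icc (0 : ℝ) 1
    · have hcu : IsCompact (K ∩ Set.Ici u) := hc.inter_right isClosed_Ici
      have hm := hcu.sInf_mem ⟨1, h1, hu.2⟩
      exact ⟨_, fun _ => ⟨hm.1, hm.2, fun k hk hku => csInf_le hcu.bddBelow ⟨hk, hku⟩⟩⟩
    · exact ⟨0, fun h => absurd h hu⟩
  choose a ha using exa
  choose b hb using exb
  have hw : ∀ u ∈ Set.Icc (0 : ℝ) 1, 0 ≤ (u - a u) / (b u - a u) ∧
      (u - a u) / (b u - a u) ≤ 1 := by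
    intro u hu
    obtain ⟨-, h2, -⟩ := ha u hu
    obtain ⟨-, h3, -⟩ := hb u hu
    exact ⟨div_nonneg (by linarith) (by linarith), div_le_one_of_le₀ (by linarith) (by linarith)⟩
  refine ⟨fun h u => h (a u) + (u - a u) / (b u - a u) * (h (b u) - h (a u)),
    fun h k u => by ring, ?_, ?_, ?_, ?_⟩
  · intro h u hu
    have e : a u = u := le_antisymm (ha u (hK1 hu)).2.1 ((ha u (hK1 hu)).2.2 u hu le_rfl)
    simp [e]
  · intro u hu
    obtain ⟨-, h2, -⟩ := ha u hu
    obtain ⟨-, h3, -⟩ := hb u hu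
    show a u + (u - a u) / (b u - a u) * (b u - a u) = u
    by_cases e : b u - a u = 0
    · rw [e]; simp; linarith
    · rw [div_mul_cancel₀ _ e]; ring
  · intro h k hk u hu
    simp only [hk (ha u hu).1, hk (hb u hu).1]
  · intro h hm u hu u' hu' huu'
    obtain ⟨a1, a2, a3⟩ := ha u hu
    obtain ⟨b1, b2, b3⟩ := hb u hu
    obtain ⟨a1', a2', a3'⟩ := ha u' hu'
    obtain ⟨b1', b2', b3'⟩ := hb u' hu'
    obtain ⟨w0, w1⟩ := hw u hu
    obtain ⟨w0', w1'⟩ := hw u' hu'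
    have m := hm a1 b1 (a2.trans b2)
    have m' := hm a1' b1' (a2'.trans b2')
    by_cases hbu : b u ≤ u'
    · have m'' := hm b1 a1' (a3' _ b1 hbu)
      have e1 : (u - a u) / (b u - a u) * (h (b u) - h (a u)) ≤ h (b u) - h (a u) :=
        mul_le_of_le_one_left (by linarith) w1
      have e2 : 0 ≤ (u' - a u') / (b u' - a u') * (h (b u') - h (a u')) :=
        mul_nonneg w0' (by linarith)
      show _ + _ ≤ _ + _
      linarith
    · push Not at hbu
      have ea : a u' = a u := by
        refine le_antisymm (a3 _ a1' ?_) (a3' _ a1 (a2.trans huu'))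
        by_contra hlt
        push Not at hlt
        linarith [b3 _ a1' hlt.le]
      have eb : b u' = b u := le_antisymm (b3' _ b1 hbu.le) (b3 _ b1' (huu'.trans b2'))
      show _ + _ ≤ _ + _
      rw [ea, eb]
      have : (u - a u) / (b u - a u) ≤ (u' - a u) / (b u - a u) :=
        div_le_div_of_nonneg_right (by linarith) (by linarith)
      have := mul_le_mul_of_nonneg_right this (sub_nonneg.2 m)
      linarith

lemma isCopula_of_boundary {C : ℝ → ℝ → ℝ}
    (hb : ∀ u ∈ Set.Icc (0:ℝ) 1, C u 0 = 0 ∧ C 0 u = 0 ∧ C u 1 = u ∧ C 1 u = u)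
    (hv : ∀ u₁ ∈ Set.Icc (0:ℝ) 1, ∀ u₂ ∈ Set.Icc (0:ℝ) 1, ∀ v₁ ∈ Set.Icc (0:ℝ) 1,
      ∀ v₂ ∈ Set.Icc (0:ℝ) 1, u₁ ≤ u₂ → v₁ ≤ v₂ →
      0 ≤ C u₂ v₂ - C u₁ v₂ - C u₂ v₁ + C u₁ v₁) : IsCopula C := by
  have z : (0:ℝ) ∈ Set.Icc (0:ℝ) 1 := by simp
  have o : (1:ℝ) ∈ Set.Icc (0:ℝ) 1 := by simp
  refine ⟨fun u hu v hv' => ⟨?_, ?_⟩, hb, hv⟩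
  · have := hv 0 z u hu 0 z v hv' hu.1 hv'.1
    rw [(hb v hv').2.1, (hb u hu).1, (hb 0 z).1] at this
    linarith
  · have := hv 0 z u hu v hv' 1 o hu.1 hv'.2
    rw [(hb 1 o).2.1, (hb v hv').2.1, (hb u hu).2.2.1] at this
    linarith [hu.2]

lemma IsQuasiDist.univDist_margins {F : EReal × EReal → ℝ} {FX FY : EReal → ℝ} (hF : IsQuasiDist F)
    (hm : HasMargins F FX FY) : UnivDist FX ∧ UnivDist FY := by
  obtain ⟨-, h0, h0', h1, hv⟩ := hF
  refine ⟨⟨fun x x' h => ?_, ?_, ?_⟩, ⟨fun y y' h => ?_, ?_, ?_⟩⟩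
  · have := hv x x' ⊥ ⊤ h bot_le (by simp [IsInfinite])
    simp only [vol, h0, hm.1] at this
    linarith
  · rw [← hm.1, h0']
  · rw [← hm.1, h1]
  · have := hv ⊥ ⊤ y y' bot_le h (by simp [IsInfinite])
    simp only [vol, h0', hm.2] at this
    linarith
  · rw [← hm.2, h0]
  · rw [← hm.2, h1]

lemma UnivDist.mem_Icc {F : EReal → ℝ} (hF : UnivDist F) (x : EReal) :
    F x ∈ Set.Icc (0 : ℝ) 1 :=
  ⟨hF.2.1 ▸ hF.1 bot_le, hF.2.2 ▸ hF.1 le_top⟩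

lemma IsDist.isQuasiDist {F : EReal × EReal → ℝ} (hF : IsDist F) : IsQuasiDist F :=
  ⟨hF.1, hF.2.1, hF.2.2.1, hF.2.2.2.1, fun a₁ a₂ b₁ b₂ ha hb _ => hF.2.2.2.2 a₁ a₂ b₁ b₂ ha hb⟩

lemma IsDist.abs_sub_le {F : EReal × EReal → ℝ} {FX FY : EReal → ℝ} (hF : IsDist F)
    (hm : HasMargins F FX FY) (x x' y y' : EReal) :
    |F (x, y) - F (x', y')| ≤ |FX x - FX x'| + |FY y - FY y'| := by
  obtain ⟨-, h0, h0', -, hv⟩ := hF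
  have hx : |F (x, y) - F (x', y)| ≤ |FX x - FX x'| := by
    wlog hxx : x' ≤ x generalizing x x'
    · rw [abs_sub_comm, abs_sub_comm (FX x)]
      exact this x' x (le_of_not_ge hxx)
    have e1 := hv x' x ⊥ y hxx bot_le
    have e2 := hv x' x y ⊤ hxx le_top
    simp only [vol, h0, hm.1] at e1 e2
    rw [abs_of_nonneg (by linarith), abs_of_nonneg (by linarith)]
    linarith
  have hy : |F (x', y) - F (x', y')| ≤ |FY y - FY y'| := by
    wlog hyy : y' ≤ y generalizing y y'
    · rw [abs_sub_comm, abs_sub_comm (FY y)]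
      refine this y' y ?_ (le_of_not_ge hyy)
      have e1 := hv (min x x') (max x x') ⊥ y' min_le_max bot_le
      have e2 := hv (min x x') (max x x') y' ⊤ min_le_max le_top
      rcases le_total x x' with h | h
      · simp only [min_eq_left h, max_eq_right h, vol, h0, hm.1] at e1 e2
        rw [abs_sub_comm, abs_sub_comm (FX x), abs_of_nonneg (by linarith),
          abs_of_nonneg (by linarith)]
        linarith
      · simp only [min_eq_right h, max_eq_left h, vol, h0, hm.1] at e1 e2
        rw [abs_of_nonneg (by linarith), abs_of_nonneg (by linarith)]
        linarith
    have e1 := hv ⊥ x' y' y bot_le hyy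
    have e2 := hv x' ⊤ y' y le_top hyy
    simp only [vol, h0', hm.2] at e1 e2
    rw [abs_of_nonneg (by linarith), abs_of_nonneg (by linarith)]
    linarith
  calc |F (x, y) - F (x', y')| ≤ |F (x, y) - F (x', y)| + |F (x', y) - F (x', y')| :=
        _root_.abs_sub_le _ _ _
    _ ≤ _ := add_le_add hx hy

/-- A distribution factors through its margins by means of a continuous function. -/
lemma IsDist.exists_continuous_factor {F : EReal × EReal → ℝ} {FX FY : EReal → ℝ} (hF : IsDist F)
    (hm : HasMargins F FX FY) :
    ∃ g : ℝ × ℝ → ℝ, Continuous g ∧ ∀ x y, g (FX x, FY y) = F (x, y) := by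
  have hL : LipschitzOnWith 2
      (fun p : ℝ × ℝ => F (Function.invFun FX p.1, Function.invFun FY p.2))
      (Set.range FX ×ˢ Set.range FY) := by
    refine LipschitzOnWith.of_dist_le_mul fun p hp q hq => ?_
    have h := hF.abs_sub_le hm (Function.invFun FX p.1) (Function.invFun FX q.1)
      (Function.invFun FY p.2) (Function.invFun FY q.2)
    rw [Function.invFun_eq hp.1, Function.invFun_eq hq.1, Function.invFun_eq hp.2,
      Function.invFun_eq hq.2] at h
    have h1 : |p.1 - q.1| ≤ dist p q := le_max_left (dist p.1 q.1) (dist p.2 q.2)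
    have h2 : |p.2 - q.2| ≤ dist p q := le_max_right (dist p.1 q.1) (dist p.2 q.2)
    rw [Real.dist_eq, NNReal.coe_ofNat]
    linarith
  obtain ⟨g, hg, hgeq⟩ := hL.extend_real
  refine ⟨g, hg.continuous, fun x y => ?_⟩
  rw [← hgeq ⟨⟨x, rfl⟩, ⟨y, rfl⟩⟩]
  have h := hF.abs_sub_le hm (Function.invFun FX (FX x)) x (Function.invFun FY (FY y)) y
  rw [Function.invFun_eq (f := FX) ⟨x, rfl⟩, Function.invFun_eq (f := FY) ⟨y, rfl⟩, sub_self, sub_self, abs_zero,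
    add_zero] at h
  exact sub_eq_zero.1 (abs_nonpos_iff.1 h)

/-- **Sklar's theorem** for distributions without right-continuity. -/
lemma IsDist.exists_copula {F : EReal × EReal → ℝ} {FX FY : EReal → ℝ} (hF : IsDist F)
    (hm : HasMargins F FX FY) :
    ∃ C : ℝ → ℝ → ℝ, IsCopula C ∧ ∀ p, F p = C (FX p.1) (FY p.2) := by
  obtain ⟨hX, hY⟩ := IsQuasiDist.univDist_margins hF.isQuasiDist hm
  obtain ⟨g, hgc, hg⟩ := hF.exists_continuous_factor hm
  set K := closure (Set.range FX)
  set L := closure (Set.range FY)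
  have hDK : ∀ x, FX x ∈ K := fun x => subset_closure ⟨x, rfl⟩
  have hDL : ∀ y, FY y ∈ L := fun y => subset_closure ⟨y, rfl⟩
  have K0 : (0 : ℝ) ∈ K := hX.2.1 ▸ hDK ⊥
  have K1 : (1 : ℝ) ∈ K := hX.2.2 ▸ hDK ⊤
  have L0 : (0 : ℝ) ∈ L := hY.2.1 ▸ hDL ⊥
  have L1 : (1 : ℝ) ∈ L := hY.2.2 ▸ hDL ⊤
  have hK : K ⊆ Set.Icc 0 1 :=
    closure_minimal (Set.range_subset_iff.2 hX.mem_Icc) isClosed_Icc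
  have hL : L ⊆ Set.Icc 0 1 :=
    closure_minimal (Set.range_subset_iff.2 hY.mem_Icc) isClosed_Icc
  have g0 : Set.EqOn (fun s => g (s, 0)) (fun _ => 0) K := by
    refine Set.EqOn.closure ?_ (by fun_prop) (by fun_prop)
    rintro _ ⟨x, rfl⟩
    simp only [← hY.2.1, hg, hF.2.1]
  have g1 : Set.EqOn (fun s => g (s, 1)) (fun s => s) K := by
    refine Set.EqOn.closure ?_ (by fun_prop) (by fun_prop)
    rintro _ ⟨x, rfl⟩
    simp only [← hY.2.2, hg, hm.1]
  have g0' : Set.EqOn (fun t => g (0, t)) (fun _ => 0) L := by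
    refine Set.EqOn.closure ?_ (by fun_prop) (by fun_prop)
    rintro _ ⟨x, rfl⟩
    simp only [← hX.2.1, hg, hF.2.2.1]
  have g1' : Set.EqOn (fun t => g (1, t)) (fun s => s) L := by
    refine Set.EqOn.closure ?_ (by fun_prop) (by fun_prop)
    rintro _ ⟨x, rfl⟩
    simp only [← hX.2.2, hg, hm.2]
  have mono_range : ∀ x₁ x₂, FX x₁ ≤ FX x₂ →
      MonotoneOn (fun t => g (FX x₂, t) - g (FX x₁, t)) L := by
    intro x₁ x₂ hx
    refine MonotoneOn.closure_of_continuous ?_ (by fun_prop)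
    rintro _ ⟨y₁, rfl⟩ _ ⟨y₂, rfl⟩ hy
    simp only
    rcases hx.eq_or_lt with e | hx'
    · simp [e]
    rcases hy.eq_or_lt with e | hy'
    · simp [e]
    have := hF.2.2.2.2 x₁ x₂ y₁ y₂ (hX.1.reflect_lt hx').le (hY.1.reflect_lt hy').le
    simp only [vol] at this
    simp only [hg]
    linarith
  have mono_L : ∀ t₁ ∈ L, ∀ t₂ ∈ L, t₁ ≤ t₂ →
      MonotoneOn (fun s => g (s, t₂) - g (s, t₁)) K := by
    intro t₁ ht₁ t₂ ht₂ ht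
    refine MonotoneOn.closure_of_continuous ?_ (by fun_prop)
    rintro _ ⟨x₁, rfl⟩ _ ⟨x₂, rfl⟩ hx
    have := mono_range x₁ x₂ hx ht₁ ht₂ ht
    simp only at this ⊢
    linarith
  obtain ⟨I, Isub, IK, Iid, Icongr, Imono⟩ :=
    exists_interpolation_operator isClosed_closure hK K0 K1
  obtain ⟨J, Jsub, JL, Jid, Jcongr, Jmono⟩ :=
    exists_interpolation_operator isClosed_closure hL L0 L1
  have Izero : ∀ u, I (fun _ => 0) u = 0 := fun u => by
    have := Isub (fun _ => 0) (fun _ => 0) u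
    simpa using this
  have Jzero : ∀ u, J (fun _ => 0) u = 0 := fun u => by
    have := Jsub (fun _ => 0) (fun _ => 0) u
    simpa using this
  refine ⟨fun u v => I (fun s => J (fun t => g (s, t)) v) u, isCopula_of_boundary ?_ ?_, ?_⟩
  · intro u hu
    refine ⟨?_, ?_, ?_, ?_⟩
    · rw [Icongr _ (fun _ => 0) (fun s hs => ?_) hu, Izero]
      simpa only [JL _ 0 L0] using g0 hs
    · rw [IK _ 0 K0, Jcongr _ _ g0' hu, Jzero]
    · rw [Icongr _ (fun s => s) (fun s hs => ?_) hu, Iid u hu]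
      simpa only [JL _ 1 L1] using g1 hs
    · rw [IK _ 1 K1, Jcongr _ _ g1' hu, Jid u hu]
  · intro u₁ hu₁ u₂ hu₂ v₁ hv₁ v₂ hv₂ hu hv
    have h : MonotoneOn (fun s => J (fun t => g (s, t)) v₂ - J (fun t => g (s, t)) v₁) K := by
      intro s₁ hs₁ s₂ hs₂ hs
      have hmon : MonotoneOn (fun t => g (s₂, t) - g (s₁, t)) L := by
        intro t₁ ht₁ t₂ ht₂ ht
        have := mono_L t₁ ht₁ t₂ ht₂ ht hs₁ hs₂ hs
        simp only at this ⊢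
        linarith
      have := Jmono _ hmon hv₁ hv₂ hv
      simp only [Jsub] at this ⊢
      linarith
    have := Imono _ h hu₁ hu₂ hu
    simp only [Isub] at this
    linarith
  · rintro ⟨x, y⟩
    show F (x, y) = I (fun s => J (fun t => g (s, t)) (FY y)) (FX x)
    rw [IK _ _ (hDK x), JL _ _ (hDL y), hg]

lemma IsCopula.isQuasiCopula {C : ℝ → ℝ → ℝ} (hC : IsCopula C) : IsQuasiCopula C := by
  obtain ⟨hr, hb, hv⟩ := hC
  have z : (0:ℝ) ∈ Set.Icc (0:ℝ) 1 := by simp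
  have o : (1:ℝ) ∈ Set.Icc (0:ℝ) 1 := by simp
  have key : ∀ u ∈ Set.Icc (0:ℝ) 1, ∀ u' ∈ Set.Icc (0:ℝ) 1, ∀ v ∈ Set.Icc (0:ℝ) 1, u ≤ u' →
      0 ≤ C u' v - C u v ∧ C u' v - C u v ≤ u' - u ∧
      0 ≤ C v u' - C v u ∧ C v u' - C v u ≤ u' - u := by
    intro u hu u' hu' v hv' h
    have e1 := hv u hu u' hu' 0 z v hv' h hv'.1
    have e2 := hv u hu u' hu' v hv' 1 o h hv'.2
    have e3 := hv 0 z v hv' u hu u' hu' hv'.1 h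
    have e4 := hv v hv' 1 o u hu u' hu' hv'.2 h
    simp only [hb u hu, hb u' hu'] at e1 e2 e3 e4
    refine ⟨?_, ?_, ?_, ?_⟩ <;> linarith
  refine ⟨hr, hb, fun u hu u' hu' v hv' h => ?_, fun u hu u' hu' v hv' v' hv'' => ?_⟩
  · have := key u hu u' hu' v hv' h
    exact ⟨by linarith, by linarith⟩
  · have h1 : |C u v - C u' v| ≤ |u - u'| := by
      rcases le_total u u' with h | h
      · have := key u hu u' hu' v hv' h
        rw [abs_sub_comm, abs_sub_comm u, abs_of_nonneg this.1, abs_of_nonneg (by linarith)]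
        exact this.2.1
      · have := key u' hu' u hu v hv' h
        rw [abs_of_nonneg this.1, abs_of_nonneg (by linarith)]
        exact this.2.1
    have h2 : |C u' v - C u' v'| ≤ |v - v'| := by
      rcases le_total v v' with h | h
      · have := key v hv' v' hv'' u' hu' h
        rw [abs_sub_comm, abs_sub_comm v, abs_of_nonneg this.2.2.1, abs_of_nonneg (by linarith)]
        exact this.2.2.2
      · have := key v' hv'' v hv' u' hu' h
        rw [abs_of_nonneg this.2.2.1, abs_of_nonneg (by linarith)]
        exact this.2.2.2
    exact (_root_.abs_sub_le _ (C u' v) _).trans (add_le_add h1 h2)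

/-- A pointwise greatest lower bound of a nonempty family of quasi-copulas is a quasi-copula. -/
lemma isQuasiCopula_of_isGLB {S : Set (ℝ → ℝ → ℝ)} {P : ℝ → ℝ → ℝ} (hne : S.Nonempty)
    (hS : ∀ C ∈ S, IsQuasiCopula C)
    (hP : ∀ u ∈ Set.Icc (0:ℝ) 1, ∀ v ∈ Set.Icc (0:ℝ) 1,
      IsGLB ((fun C => C u v) '' S) (P u v)) : IsQuasiCopula P := by
  have z : (0:ℝ) ∈ Set.Icc (0:ℝ) 1 := by simp
  have o : (1:ℝ) ∈ Set.Icc (0:ℝ) 1 := by simp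
  obtain ⟨C₀, hC₀⟩ := hne
  have le : ∀ u ∈ Set.Icc (0:ℝ) 1, ∀ v ∈ Set.Icc (0:ℝ) 1, ∀ C ∈ S, P u v ≤ C u v :=
    fun u hu v hv C hC => (hP u hu v hv).1 ⟨C, hC, rfl⟩
  have ge : ∀ u ∈ Set.Icc (0:ℝ) 1, ∀ v ∈ Set.Icc (0:ℝ) 1, ∀ r, (∀ C ∈ S, r ≤ C u v) →
      r ≤ P u v := by
    intro u hu v hv r h
    refine (hP u hu v hv).2 ?_
    rintro _ ⟨C, hC, rfl⟩
    exact h C hC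
  have const : ∀ u ∈ Set.Icc (0:ℝ) 1, ∀ v ∈ Set.Icc (0:ℝ) 1, ∀ r, (∀ C ∈ S, C u v = r) →
      P u v = r := fun u hu v hv r h =>
    le_antisymm ((le u hu v hv C₀ hC₀).trans (h C₀ hC₀).le) (ge u hu v hv r fun C hC => (h C hC).ge)
  refine ⟨fun u hu v hv => ⟨?_, ?_⟩, fun u hu => ⟨?_, ?_, ?_, ?_⟩,
    fun u hu u' hu' v hv h => ⟨?_, ?_⟩, fun u hu u' hu' v hv v' hv' => ?_⟩
  · exact ge u hu v hv 0 fun C hC => ((hS C hC).1 u hu v hv).1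
  · exact (le u hu v hv C₀ hC₀).trans ((hS C₀ hC₀).1 u hu v hv).2
  · exact const u hu 0 z 0 fun C hC => ((hS C hC).2.1 u hu).1
  · exact const 0 z u hu 0 fun C hC => ((hS C hC).2.1 u hu).2.1
  · exact const u hu 1 o u fun C hC => ((hS C hC).2.1 u hu).2.2.1
  · exact const 1 o u hu u fun C hC => ((hS C hC).2.1 u hu).2.2.2
  · exact ge u' hu' v hv _ fun C hC =>
      (le u hu v hv C hC).trans ((hS C hC).2.2.1 u hu u' hu' v hv h).1
  · exact ge v hv u' hu' _ fun C hC =>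
      (le v hv u hu C hC).trans ((hS C hC).2.2.1 u hu u' hu' v hv h).2
  · have e1 : P u v - (|u - u'| + |v - v'|) ≤ P u' v' := ge u' hu' v' hv' _ fun C hC => by
      have := (abs_le.1 ((hS C hC).2.2.2 u hu u' hu' v hv v' hv')).2
      linarith [le u hu v hv C hC]
    have e2 : P u' v' - (|u - u'| + |v - v'|) ≤ P u v := ge u hu v hv _ fun C hC => by
      have := (abs_le.1 ((hS C hC).2.2.2 u hu u' hu' v hv v' hv')).1
      linarith [le u' hu' v' hv' C hC]
    exact abs_le.2 ⟨by linarith, by linarith⟩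

/-- A pointwise least upper bound of a nonempty family of quasi-copulas is a quasi-copula. -/
lemma isQuasiCopula_of_isLUB {S : Set (ℝ → ℝ → ℝ)} {P : ℝ → ℝ → ℝ} (hne : S.Nonempty)
    (hS : ∀ C ∈ S, IsQuasiCopula C)
    (hP : ∀ u ∈ Set.Icc (0:ℝ) 1, ∀ v ∈ Set.Icc (0:ℝ) 1,
      IsLUB ((fun C => C u v) '' S) (P u v)) : IsQuasiCopula P := by
  have z : (0:ℝ) ∈ Set.Icc (0:ℝ) 1 := by simp
  have o : (1:ℝ) ∈ Set.Icc (0:ℝ) 1 := by simp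
  obtain ⟨C₀, hC₀⟩ := hne
  have ge : ∀ u ∈ Set.Icc (0:ℝ) 1, ∀ v ∈ Set.Icc (0:ℝ) 1, ∀ C ∈ S, C u v ≤ P u v :=
    fun u hu v hv C hC => (hP u hu v hv).1 ⟨C, hC, rfl⟩
  have le : ∀ u ∈ Set.Icc (0:ℝ) 1, ∀ v ∈ Set.Icc (0:ℝ) 1, ∀ r, (∀ C ∈ S, C u v ≤ r) →
      P u v ≤ r := by
    intro u hu v hv r h
    refine (hP u hu v hv).2 ?_
    rintro _ ⟨C, hC, rfl⟩
    exact h C hC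
  have const : ∀ u ∈ Set.Icc (0:ℝ) 1, ∀ v ∈ Set.Icc (0:ℝ) 1, ∀ r, (∀ C ∈ S, C u v = r) →
      P u v = r := fun u hu v hv r h =>
    le_antisymm (le u hu v hv r fun C hC => (h C hC).le) ((h C₀ hC₀).ge.trans (ge u hu v hv C₀ hC₀))
  refine ⟨fun u hu v hv => ⟨?_, ?_⟩, fun u hu => ⟨?_, ?_, ?_, ?_⟩,
    fun u hu u' hu' v hv h => ⟨?_, ?_⟩, fun u hu u' hu' v hv v' hv' => ?_⟩
  · exact ((hS C₀ hC₀).1 u hu v hv).1.trans (ge u hu v hv C₀ hC₀)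
  · exact le u hu v hv 1 fun C hC => ((hS C hC).1 u hu v hv).2
  · exact const u hu 0 z 0 fun C hC => ((hS C hC).2.1 u hu).1
  · exact const 0 z u hu 0 fun C hC => ((hS C hC).2.1 u hu).2.1
  · exact const u hu 1 o u fun C hC => ((hS C hC).2.1 u hu).2.2.1
  · exact const 1 o u hu u fun C hC => ((hS C hC).2.1 u hu).2.2.2
  · exact le u hu v hv _ fun C hC =>
      ((hS C hC).2.2.1 u hu u' hu' v hv h).1.trans (ge u' hu' v hv C hC)
  · exact le v hv u hu _ fun C hC =>
      ((hS C hC).2.2.1 u hu u' hu' v hv h).2.trans (ge v hv u' hu' C hC)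
  · have e1 : P u v ≤ P u' v' + (|u - u'| + |v - v'|) := le u hu v hv _ fun C hC => by
      have := (abs_le.1 ((hS C hC).2.2.2 u hu u' hu' v hv v' hv')).2
      linarith [ge u' hu' v' hv' C hC]
    have e2 : P u' v' ≤ P u v + (|u - u'| + |v - v'|) := le u' hu' v' hv' _ fun C hC => by
      have := (abs_le.1 ((hS C hC).2.2.2 u hu u' hu' v hv v' hv')).1
      linarith [ge u hu v hv C hC]
    exact abs_le.2 ⟨by linarith, by linarith⟩

/-- The composition of a copula with univariate distribution functions is a distribution. -/
lemma IsCopula.isDist_comp {C : ℝ → ℝ → ℝ} {FX FY : EReal → ℝ} (hC : IsCopula C)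
    (hX : UnivDist FX) (hY : UnivDist FY) :
    IsDist (fun p => C (FX p.1) (FY p.2)) ∧ HasMargins (fun p => C (FX p.1) (FY p.2)) FX FY := by
  obtain ⟨hr, hb, hv⟩ := hC
  refine ⟨⟨fun p => hr _ (hX.mem_Icc _) _ (hY.mem_Icc _), fun x => ?_, fun y => ?_, ?_,
    fun a₁ a₂ b₁ b₂ ha hb' => hv _ (hX.mem_Icc _) _ (hX.mem_Icc _) _ (hY.mem_Icc _) _
      (hY.mem_Icc _) (hX.1 ha) (hY.1 hb')⟩, fun x => ?_, fun y => ?_⟩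
  · simp only [hY.2.1, (hb _ (hX.mem_Icc x)).1]
  · simp only [hX.2.1, (hb _ (hY.mem_Icc y)).2.1]
  · simp only [hX.2.2, hY.2.2, (hb 1 (by simp)).2.2.1]
  · simp only [hY.2.2, (hb _ (hX.mem_Icc x)).2.2.1]
  · simp only [hX.2.2, (hb _ (hY.mem_Icc y)).2.2.2]

/-- **Imprecise Sklar theorem for fixed margins, (2) ⇔ (3).** -/
theorem imprecise_sklar_fixed_margins_two_iff_three
    (FX FY : EReal → ℝ) (A B : EReal × EReal → ℝ)
    (hA : IsQuasiDist A) (hB : IsQuasiDist B)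
    (hmA : HasMargins A FX FY) (hmB : HasMargins B FX FY)
    (hAB : ∀ p, A p ≤ B p) :
    ((Dset FX FY A B).Nonempty ∧
        (∀ p, A p = pinf (Dset FX FY A B) p) ∧
        (∀ p, B p = psup (Dset FX FY A B) p)) ↔
      (∃ P Q : ℝ → ℝ → ℝ,
        (∀ p : EReal × EReal, A p = P (FX p.1) (FY p.2)) ∧
        (∀ p : EReal × EReal, B p = Q (FX p.1) (FY p.2)) ∧
        CoherentImprecise P Q) := by
  obtain ⟨hX, hY⟩ := IsQuasiDist.univDist_margins hA hmA
  constructor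
  · rintro ⟨⟨F₀, hF₀⟩, hinf, hsup⟩
    set S : Set (ℝ → ℝ → ℝ) :=
      {C | IsCopula C ∧ (fun p : EReal × EReal => C (FX p.1) (FY p.2)) ∈ Dset FX FY A B}
    have lift : ∀ F ∈ Dset FX FY A B, ∃ C ∈ S, F = fun p => C (FX p.1) (FY p.2) := by
      intro F hF
      obtain ⟨C, hC, hFC⟩ := hF.1.exists_copula hF.2.1
      have e : F = fun p => C (FX p.1) (FY p.2) := funext hFC
      exact ⟨C, ⟨hC, e ▸ hF⟩, e⟩
    have hne : S.Nonempty := by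
      obtain ⟨C, hC, -⟩ := lift F₀ hF₀
      exact ⟨C, hC⟩
    have himage : ∀ p : EReal × EReal,
        (fun F : EReal × EReal → ℝ => F p) '' Dset FX FY A B =
          (fun C : ℝ → ℝ → ℝ => C (FX p.1) (FY p.2)) '' S := by
      intro p
      ext r
      constructor
      · rintro ⟨F, hF, rfl⟩
        obtain ⟨C, hC, rfl⟩ := lift F hF
        exact ⟨C, hC, rfl⟩
      · rintro ⟨C, hC, rfl⟩
        exact ⟨_, hC.2, rfl⟩
    have hglb : ∀ u ∈ Set.Icc (0:ℝ) 1, ∀ v ∈ Set.Icc (0:ℝ) 1,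
        IsGLB ((fun C => C u v) '' S) (sInf ((fun C : ℝ → ℝ → ℝ => C u v) '' S)) := by
      refine fun u hu v hv => isGLB_csInf (hne.image _) ⟨0, ?_⟩
      rintro _ ⟨C, hC, rfl⟩
      exact (hC.1.1 u hu v hv).1
    have hlub : ∀ u ∈ Set.Icc (0:ℝ) 1, ∀ v ∈ Set.Icc (0:ℝ) 1,
        IsLUB ((fun C => C u v) '' S) (sSup ((fun C : ℝ → ℝ → ℝ => C u v) '' S)) := by
      refine fun u hu v hv => isLUB_csSup (hne.image _) ⟨1, ?_⟩
      rintro _ ⟨C, hC, rfl⟩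
      exact (hC.1.1 u hu v hv).2
    set P : ℝ → ℝ → ℝ := fun u v => sInf ((fun C : ℝ → ℝ → ℝ => C u v) '' S)
    set Q : ℝ → ℝ → ℝ := fun u v => sSup ((fun C : ℝ → ℝ → ℝ => C u v) '' S)
    have hsub : S ⊆ Cset P Q := fun C hC => ⟨hC.1, fun u hu v hv =>
      ⟨(hglb u hu v hv).1 ⟨C, hC, rfl⟩, (hlub u hu v hv).1 ⟨C, hC, rfl⟩⟩⟩
    have hq : ∀ C ∈ S, IsQuasiCopula C := fun C hC => hC.1.isQuasiCopula
    refine ⟨P, Q, fun p => ?_, fun p => ?_, isQuasiCopula_of_isGLB hne hq hglb,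
      isQuasiCopula_of_isLUB hne hq hlub, fun u hu v hv => ?_, hne.mono hsub,
      fun u hu v hv => ⟨?_, ?_⟩⟩
    · rw [hinf p, pinf, himage]
    · rw [hsup p, psup, himage]
    · obtain ⟨C, hC⟩ := hne
      exact ((hsub hC).2 u hu v hv).1.trans ((hsub hC).2 u hu v hv).2
    · refine (IsGLB.csInf_eq ⟨?_, fun r hr => ?_⟩ ((hne.mono hsub).image _)).symm
      · rintro _ ⟨C, hC, rfl⟩
        exact (hC.2 u hu v hv).1
      · exact (hglb u hu v hv).2 (lowerBounds_mono_set (Set.image_mono hsub) hr)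
    · refine (IsLUB.csSup_eq ⟨?_, fun r hr => ?_⟩ ((hne.mono hsub).image _)).symm
      · rintro _ ⟨C, hC, rfl⟩
        exact (hC.2 u hu v hv).2
      · exact (hlub u hu v hv).2 (upperBounds_mono_set (Set.image_mono hsub) hr)
  · rintro ⟨P, Q, hAP, hBQ, -, -, -, hne, hPQ⟩
    have hmem : ∀ C ∈ Cset P Q,
        (fun p : EReal × EReal => C (FX p.1) (FY p.2)) ∈ Dset FX FY A B := by
      intro C hC
      obtain ⟨h1, h2⟩ := hC.1.isDist_comp hX hY
      refine ⟨h1, h2, fun p => ?_⟩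
      rw [hAP, hBQ]
      exact hC.2 _ (hX.mem_Icc _) _ (hY.mem_Icc _)
    have hD : (Dset FX FY A B).Nonempty := by
      obtain ⟨C, hC⟩ := hne
      exact ⟨_, hmem C hC⟩
    refine ⟨hD, fun p => le_antisymm ?_ ?_, fun p => le_antisymm ?_ ?_⟩
    · refine le_csInf (hD.image _) ?_
      rintro _ ⟨F, hF, rfl⟩
      exact (hF.2.2 p).1
    · rw [hAP, (hPQ _ (hX.mem_Icc p.1) _ (hY.mem_Icc p.2)).1]
      refine le_csInf (hne.image _) ?_
      rintro _ ⟨C, hC, rfl⟩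
      refine csInf_le ⟨A p, ?_⟩ ⟨_, hmem C hC, rfl⟩
      rintro _ ⟨F, hF, rfl⟩
      exact (hF.2.2 p).1
    · rw [hBQ, (hPQ _ (hX.mem_Icc p.1) _ (hY.mem_Icc p.2)).2]
      refine csSup_le (hne.image _) ?_
      rintro _ ⟨C, hC, rfl⟩
      refine le_csSup ⟨B p, ?_⟩ ⟨_, hmem C hC, rfl⟩
      rintro _ ⟨F, hF, rfl⟩
      exact (hF.2.2 p).2
    · refine csSup_le (hD.image _) ?_
      rintro _ ⟨F, hF, rfl⟩
      exact (hF.2.2 p).2
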